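/- For every valid online rotation strategy σ, every integer m ≥ 1, and every real p > 0, there exists a stream L of m² + 1 pieces such that OPT(L) ≤ 2p² and ALG_σ(L) ≥ m·p², where the cost is the area of the bounding box. -/

import Mathlib

open Set

/-- A piece is a pair (w,h) of (intended positive) real numbers. -/
abbrev Piece := ℝ × ℝ

/-- Both edge lengths of the piece are positive. -/
def PiecePos (p : Piece) : Prop := 0 < p.1 ∧ 0 < p.2

/-- The axis-parallel closed rectangle obtained by placing piece `p` by
translation at the point `q`. -/
def placedRect (p : Piece) (q : ℝ × ℝ) : Set (ℝ × ℝ) :=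
  Set.Icc q.1 (q.1 + p.1) ×ˢ Set.Icc q.2 (q.2 + p.2)

/-- Width of the axis-parallel bounding box of a set in the plane. -/
noncomputable def boxWidth (S : Set (ℝ × ℝ)) : ℝ :=
  sSup (Prod.fst '' S) - sInf (Prod.fst '' S)

/-- Height of the axis-parallel bounding box of a set in the plane. -/
noncomputable def boxHeight (S : Set (ℝ × ℝ)) : ℝ :=
  sSup (Prod.snd '' S) - sInf (Prod.snd '' S)

/-! ### Translations only -/

/-- `pos` is a packing (by translations) of the list `L` of pieces:
the placed rectangles have pairwise disjoint interiors. -/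
def IsPacking (L : List Piece) (pos : Fin L.length → ℝ × ℝ) : Prop :=
  ∀ i j : Fin L.length, i ≠ j →
    Disjoint (interior (placedRect (L.get i) (pos i)))
             (interior (placedRect (L.get j) (pos j)))

/-- The union of the placed rectangles. -/
def packedSet (L : List Piece) (pos : Fin L.length → ℝ × ℝ) : Set (ℝ × ℝ) :=
  ⋃ i : Fin L.length, placedRect (L.get i) (pos i)

/-- Perimeter of the bounding box of a packing. -/
noncomputable def periCost (L : List Piece) (pos : Fin L.length → ℝ × ℝ) : ℝ :=
  2 * (boxWidth (packedSet L pos) + boxHeight (packedSet L pos))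

/-- Area of the bounding box of a packing. -/
noncomputable def areaCost (L : List Piece) (pos : Fin L.length → ℝ × ℝ) : ℝ :=
  boxWidth (packedSet L pos) * boxHeight (packedSet L pos)

/-- Optimal offline bounding-box perimeter for the pieces of `L`. -/
noncomputable def optPeri (L : List Piece) : ℝ :=
  sInf { c | ∃ pos : Fin L.length → ℝ × ℝ, IsPacking L pos ∧ periCost L pos = c }

/-- Optimal offline bounding-box area for the pieces of `L`. -/
noncomputable def optArea (L : List Piece) : ℝ :=
  sInf { c | ∃ pos : Fin L.length → ℝ × ℝ, IsPacking L pos ∧ areaCost L pos = c }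

/-- The positions chosen by the online strategy `σ` on the stream `L`:
the `i`-th piece is placed at the point chosen by `σ` as a function of the
first `i+1` pieces. -/
def onlinePos (σ : List Piece → ℝ × ℝ) (L : List Piece) :
    Fin L.length → ℝ × ℝ :=
  fun i => σ (L.take ((i : ℕ) + 1))

/-- `σ` is a valid online translation strategy: on every stream of pieces it
produces a packing. -/
def StrategyValid (σ : List Piece → ℝ × ℝ) : Prop :=
  ∀ L : List Piece, (∀ p ∈ L, PiecePos p) → IsPacking L (onlinePos σ L)

/-- Perimeter of the bounding box of the packing produced by `σ` on `L`. -/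
noncomputable def algPeri (σ : List Piece → ℝ × ℝ) (L : List Piece) : ℝ :=
  periCost L (onlinePos σ L)

/-- Area of the bounding box of the packing produced by `σ` on `L`. -/
noncomputable def algArea (σ : List Piece → ℝ × ℝ) (L : List Piece) : ℝ :=
  areaCost L (onlinePos σ L)

/-! ### Rotations by 90° allowed -/

/-- The piece `p` in the orientation given by `r`: rotated by 90° if `r` is
`true`. -/
def orient (p : Piece) (r : Bool) : Piece := if r then (p.2, p.1) else p

/-- `pos, rot` is a packing with rotations of the list `L` of pieces. -/
def IsRotPacking (L : List Piece) (pos : Fin L.length → ℝ × ℝ)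
    (rot : Fin L.length → Bool) : Prop :=
  ∀ i j : Fin L.length, i ≠ j →
    Disjoint (interior (placedRect (orient (L.get i) (rot i)) (pos i)))
             (interior (placedRect (orient (L.get j) (rot j)) (pos j)))

/-- The union of the placed (possibly rotated) rectangles. -/
def packedRotSet (L : List Piece) (pos : Fin L.length → ℝ × ℝ)
    (rot : Fin L.length → Bool) : Set (ℝ × ℝ) :=
  ⋃ i : Fin L.length, placedRect (orient (L.get i) (rot i)) (pos i)

/-- Perimeter of the bounding box of a packing with rotations. -/
noncomputable def periRotCost (L : List Piece) (pos : Fin L.length → ℝ × ℝ)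
    (rot : Fin L.length → Bool) : ℝ :=
  2 * (boxWidth (packedRotSet L pos rot) + boxHeight (packedRotSet L pos rot))

/-- Area of the bounding box of a packing with rotations. -/
noncomputable def areaRotCost (L : List Piece) (pos : Fin L.length → ℝ × ℝ)
    (rot : Fin L.length → Bool) : ℝ :=
  boxWidth (packedRotSet L pos rot) * boxHeight (packedRotSet L pos rot)

/-- Optimal offline bounding-box perimeter with rotations allowed. -/
noncomputable def optRotPeri (L : List Piece) : ℝ :=
  sInf { c | ∃ (pos : Fin L.length → ℝ × ℝ) (rot : Fin L.length → Bool),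
    IsRotPacking L pos rot ∧ periRotCost L pos rot = c }

/-- Optimal offline bounding-box area with rotations allowed. -/
noncomputable def optRotArea (L : List Piece) : ℝ :=
  sInf { c | ∃ (pos : Fin L.length → ℝ × ℝ) (rot : Fin L.length → Bool),
    IsRotPacking L pos rot ∧ areaRotCost L pos rot = c }

/-- The positions chosen by the online rotation strategy `σ` on the stream `L`. -/
def onlineRotPos (σ : List Piece → (ℝ × ℝ) × Bool) (L : List Piece) :
    Fin L.length → ℝ × ℝ :=
  fun i => (σ (L.take ((i : ℕ) + 1))).1

/-- The orientations chosen by the online rotation strategy `σ` on the stream `L`. -/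
def onlineRot (σ : List Piece → (ℝ × ℝ) × Bool) (L : List Piece) :
    Fin L.length → Bool :=
  fun i => (σ (L.take ((i : ℕ) + 1))).2

/-- `σ` is a valid online rotation strategy: on every stream of pieces it
produces a packing with rotations. -/
def RotStrategyValid (σ : List Piece → (ℝ × ℝ) × Bool) : Prop :=
  ∀ L : List Piece, (∀ p ∈ L, PiecePos p) →
    IsRotPacking L (onlineRotPos σ L) (onlineRot σ L)

/-- Perimeter of the bounding box of the packing produced by `σ` on `L`. -/
noncomputable def algRotPeri (σ : List Piece → (ℝ × ℝ) × Bool) (L : List Piece) : ℝ :=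
  periRotCost L (onlineRotPos σ L) (onlineRot σ L)

/-- Area of the bounding box of the packing produced by `σ` on `L`. -/
noncomputable def algRotArea (σ : List Piece → (ℝ × ℝ) × Bool) (L : List Piece) : ℝ :=
  areaRotCost L (onlineRotPos σ L) (onlineRot σ L)

/-! ### Square pieces, bounding-square cost -/

/-- The axis-parallel closed square of side `s` placed at the point `q`. -/
def placedSq (s : ℝ) (q : ℝ × ℝ) : Set (ℝ × ℝ) :=
  Set.Icc q.1 (q.1 + s) ×ˢ Set.Icc q.2 (q.2 + s)

/-- `pos` is a packing of the list `L` of square pieces. -/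
def IsSqPacking (L : List ℝ) (pos : Fin L.length → ℝ × ℝ) : Prop :=
  ∀ i j : Fin L.length, i ≠ j →
    Disjoint (interior (placedSq (L.get i) (pos i)))
             (interior (placedSq (L.get j) (pos j)))

/-- The union of the placed squares. -/
def packedSqSet (L : List ℝ) (pos : Fin L.length → ℝ × ℝ) : Set (ℝ × ℝ) :=
  ⋃ i : Fin L.length, placedSq (L.get i) (pos i)

/-- Area of the smallest axis-parallel square containing all placed squares. -/
noncomputable def sqCost (L : List ℝ) (pos : Fin L.length → ℝ × ℝ) : ℝ :=
  (max (boxWidth (packedSqSet L pos)) (boxHeight (packedSqSet L pos))) ^ 2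

/-- Optimal offline bounding-square area for the square pieces of `L`. -/
noncomputable def optSq (L : List ℝ) : ℝ :=
  sInf { c | ∃ pos : Fin L.length → ℝ × ℝ, IsSqPacking L pos ∧ sqCost L pos = c }

/-- The positions chosen by the online strategy `σ` on the stream `L` of
square pieces. -/
def onlineSqPos (σ : List ℝ → ℝ × ℝ) (L : List ℝ) : Fin L.length → ℝ × ℝ :=
  fun i => σ (L.take ((i : ℕ) + 1))

/-- `σ` is a valid online translation strategy for square pieces. -/
def SqStrategyValid (σ : List ℝ → ℝ × ℝ) : Prop :=
  ∀ L : List ℝ, (∀ s ∈ L, 0 < s) → IsSqPacking L (onlineSqPos σ L)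

/-- Bounding-square area of the packing produced by `σ` on `L`. -/
noncomputable def algSq (σ : List ℝ → ℝ × ℝ) (L : List ℝ) : ℝ :=
  sqCost L (onlineSqPos σ L)

open MeasureTheory in
theorem volume_interior_placedRect (p : Piece) (q : ℝ × ℝ) :
    volume (interior (placedRect p q)) = ENNReal.ofReal p.1 * ENNReal.ofReal p.2 := by
  rw [placedRect, interior_prod_eq, interior_Icc, interior_Icc, Measure.volume_eq_prod,
    Measure.prod_prod, Real.volume_Ioo, Real.volume_Ioo, add_sub_cancel_left,
    add_sub_cancel_left]

theorem disjoint_interior_placedRect {p₁ p₂ : Piece} {q₁ q₂ : ℝ × ℝ}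
    (h : q₁.1 + p₁.1 ≤ q₂.1 ∨ q₁.2 + p₁.2 ≤ q₂.2) :
    Disjoint (interior (placedRect p₁ q₁)) (interior (placedRect p₂ q₂)) := by
  simp only [placedRect, interior_prod_eq, interior_Icc]
  rw [Set.disjoint_left]
  rintro ⟨x, y⟩ ⟨⟨_, _⟩, _, _⟩ ⟨⟨_, _⟩, _, _⟩
  rcases h with h | h <;> simp_all <;> linarith

theorem placedRect_nonempty {p : Piece} (hp : PiecePos p) (q : ℝ × ℝ) :
    (placedRect p q).Nonempty :=
  ⟨q, ⟨le_rfl, le_add_of_nonneg_right hp.1.le⟩, le_rfl, le_add_of_nonneg_right hp.2.le⟩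

theorem PiecePos.orient {p : Piece} (hp : PiecePos p) (r : Bool) : PiecePos (orient p r) := by
  cases r
  · exact hp
  · exact ⟨hp.2, hp.1⟩

theorem isBounded_packedRotSet (L : List Piece) (pos : Fin L.length → ℝ × ℝ)
    (rot : Fin L.length → Bool) : Bornology.IsBounded (packedRotSet L pos rot) :=
  (isCompact_iUnion fun _ => isCompact_Icc.prod isCompact_Icc).isBounded

theorem bddAbove_fst_image {S : Set (ℝ × ℝ)} (hS : Bornology.IsBounded S) :
    BddAbove (Prod.fst '' S) := hS.image_fst.bddAbove

theorem bddBelow_fst_image {S : Set (ℝ × ℝ)} (hS : Bornology.IsBounded S) :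
    BddBelow (Prod.fst '' S) := hS.image_fst.bddBelow

theorem bddAbove_snd_image {S : Set (ℝ × ℝ)} (hS : Bornology.IsBounded S) :
    BddAbove (Prod.snd '' S) := hS.image_snd.bddAbove

theorem bddBelow_snd_image {S : Set (ℝ × ℝ)} (hS : Bornology.IsBounded S) :
    BddBelow (Prod.snd '' S) := hS.image_snd.bddBelow

theorem boxWidth_mono {S T : Set (ℝ × ℝ)} (hS : S.Nonempty) (hT : Bornology.IsBounded T)
    (h : S ⊆ T) : boxWidth S ≤ boxWidth T :=
  sub_le_sub (csSup_le_csSup (bddAbove_fst_image hT) (hS.image _) (image_mono h))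
    (csInf_le_csInf (bddBelow_fst_image hT) (hS.image _) (image_mono h))

theorem boxHeight_mono {S T : Set (ℝ × ℝ)} (hS : S.Nonempty) (hT : Bornology.IsBounded T)
    (h : S ⊆ T) : boxHeight S ≤ boxHeight T :=
  sub_le_sub (csSup_le_csSup (bddAbove_snd_image hT) (hS.image _) (image_mono h))
    (csInf_le_csInf (bddBelow_snd_image hT) (hS.image _) (image_mono h))

theorem boxWidth_nonneg {S : Set (ℝ × ℝ)} (hS : Bornology.IsBounded S) : 0 ≤ boxWidth S :=
  sub_nonneg.2 (Real.sInf_le_sSup _ (bddBelow_fst_image hS) (bddAbove_fst_image hS))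

theorem boxHeight_nonneg {S : Set (ℝ × ℝ)} (hS : Bornology.IsBounded S) : 0 ≤ boxHeight S :=
  sub_nonneg.2 (Real.sInf_le_sSup _ (bddBelow_snd_image hS) (bddAbove_snd_image hS))

theorem boxWidth_placedRect {p : Piece} (hp : PiecePos p) (q : ℝ × ℝ) :
    boxWidth (placedRect p q) = p.1 := by
  have h1 : q.1 ≤ q.1 + p.1 := by linarith [hp.1]
  have h2 : q.2 ≤ q.2 + p.2 := by linarith [hp.2]
  rw [boxWidth, placedRect, fst_image_prod _ (nonempty_Icc.2 h2), csSup_Icc h1, csInf_Icc h1]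
  ring

theorem boxHeight_placedRect {p : Piece} (hp : PiecePos p) (q : ℝ × ℝ) :
    boxHeight (placedRect p q) = p.2 := by
  have h1 : q.1 ≤ q.1 + p.1 := by linarith [hp.1]
  have h2 : q.2 ≤ q.2 + p.2 := by linarith [hp.2]
  rw [boxHeight, placedRect, snd_image_prod (nonempty_Icc.2 h1), csSup_Icc h2, csInf_Icc h2]
  ring

theorem isBounded_placedRect (p : Piece) (q : ℝ × ℝ) : Bornology.IsBounded (placedRect p q) :=
  (isCompact_Icc.prod isCompact_Icc).isBounded

/-- A bounded set lies in its bounding box. -/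
theorem subset_placedRect_box {S : Set (ℝ × ℝ)} (hS : Bornology.IsBounded S) :
    S ⊆ placedRect (boxWidth S, boxHeight S) (sInf (Prod.fst '' S), sInf (Prod.snd '' S)) := by
  intro x hx
  simp only [placedRect, boxWidth, boxHeight, mem_prod, mem_Icc, add_sub_cancel]
  exact ⟨⟨csInf_le (bddBelow_fst_image hS) (mem_image_of_mem _ hx),
      le_csSup (bddAbove_fst_image hS) (mem_image_of_mem _ hx)⟩,
    csInf_le (bddBelow_snd_image hS) (mem_image_of_mem _ hx),
      le_csSup (bddAbove_snd_image hS) (mem_image_of_mem _ hx)⟩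

theorem areaRotCost_nonneg (L : List Piece) (pos : Fin L.length → ℝ × ℝ)
    (rot : Fin L.length → Bool) : 0 ≤ areaRotCost L pos rot :=
  mul_nonneg (boxWidth_nonneg (isBounded_packedRotSet L pos rot))
    (boxHeight_nonneg (isBounded_packedRotSet L pos rot))

theorem optRotArea_le {L : List Piece} {pos : Fin L.length → ℝ × ℝ} {rot : Fin L.length → Bool}
    (h : IsRotPacking L pos rot) : optRotArea L ≤ areaRotCost L pos rot :=
  csInf_le ⟨0, by rintro _ ⟨pos, rot, -, rfl⟩; exact areaRotCost_nonneg L pos rot⟩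
    ⟨pos, rot, h, rfl⟩

theorem placedRect_subset_packedRotSet (L : List Piece) (pos : Fin L.length → ℝ × ℝ)
    (rot : Fin L.length → Bool) (i : Fin L.length) :
    placedRect (orient (L.get i) (rot i)) (pos i) ⊆ packedRotSet L pos rot :=
  subset_iUnion (fun i : Fin L.length => placedRect (orient (L.get i) (rot i)) (pos i)) i

theorem packedRotSet_nonempty {L : List Piece} (hL : ∀ q ∈ L, PiecePos q)
    (pos : Fin L.length → ℝ × ℝ) (rot : Fin L.length → Bool) (h : L ≠ []) :
    (packedRotSet L pos rot).Nonempty :=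
  (placedRect_nonempty ((hL _ (L.get_mem ⟨0, List.length_pos_iff.2 h⟩)).orient _) _).mono
    (placedRect_subset_packedRotSet L pos rot ⟨0, List.length_pos_iff.2 h⟩)

open MeasureTheory in
/-- The total area of the pieces is at most the area of the bounding box of a packing. -/
theorem IsRotPacking.sum_area_le {L : List Piece} (hL : ∀ q ∈ L, PiecePos q)
    {pos : Fin L.length → ℝ × ℝ} {rot : Fin L.length → Bool} (h : IsRotPacking L pos rot) :
    ∑ i, (L.get i).1 * (L.get i).2 ≤ areaRotCost L pos rot := by
  have hb := isBounded_packedRotSet L pos rot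
  have hpos : ∀ i, PiecePos (L.get i) := fun i => hL _ (L.get_mem i)
  have hvol : ∀ i, volume (interior (placedRect (orient (L.get i) (rot i)) (pos i))) =
      ENNReal.ofReal ((L.get i).1 * (L.get i).2) := by
    intro i
    rw [volume_interior_placedRect, ENNReal.ofReal_mul (hpos i).1.le]
    cases rot i
    · rfl
    · exact mul_comm _ _
  have hbox : interior (packedRotSet L pos rot) ⊆ interior (placedRect _ _) :=
    interior_mono (subset_placedRect_box hb)
  have hsum : ∑ i, ENNReal.ofReal ((L.get i).1 * (L.get i).2) ≤
      ENNReal.ofReal (areaRotCost L pos rot) := by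
    rw [areaRotCost, ENNReal.ofReal_mul (boxWidth_nonneg hb)]
    refine le_trans ?_ ((measure_mono hbox).trans_eq (volume_interior_placedRect _ _))
    simp_rw [← hvol]
    rw [← tsum_fintype (L := .unconditional _), ← measure_iUnion h fun i => isOpen_interior.measurableSet]
    exact measure_mono (iUnion_subset fun i =>
      interior_mono (placedRect_subset_packedRotSet L pos rot i))
  rwa [← ENNReal.ofReal_sum_of_nonneg fun i _ => (mul_pos (hpos i).1 (hpos i).2).le,
    ENNReal.ofReal_le_ofReal_iff (areaRotCost_nonneg L pos rot)] at hsum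

/-- An upper bound on the optimum from an unrotated packing inside a given box. -/
theorem optRotArea_le_of_separated {L : List Piece} (hL : ∀ q ∈ L, PiecePos q) (hne : L ≠ [])
    (pos : Fin L.length → ℝ × ℝ) {B : Piece}
    (hB : PiecePos B)
    (hsep : ∀ i j, i < j → (pos i).1 + (L.get i).1 ≤ (pos j).1 ∨
      (pos i).2 + (L.get i).2 ≤ (pos j).2)
    (hin : ∀ i, 0 ≤ (pos i).1 ∧ (pos i).1 + (L.get i).1 ≤ B.1 ∧
      0 ≤ (pos i).2 ∧ (pos i).2 + (L.get i).2 ≤ B.2) :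
    optRotArea L ≤ B.1 * B.2 := by
  have hpack : IsRotPacking L pos fun _ => false := by
    intro i j hij
    rcases lt_or_gt_of_ne hij with h | h
    · exact disjoint_interior_placedRect (hsep i j h)
    · exact (disjoint_interior_placedRect (hsep j i h)).symm
  have hsub : packedRotSet L pos (fun _ => false) ⊆ placedRect B 0 := by
    refine iUnion_subset fun i => ?_
    obtain ⟨h1, h2, h3, h4⟩ := hin i
    refine prod_mono (Icc_subset_Icc h1 ?_) (Icc_subset_Icc h3 ?_)
    · simpa [orient] using h2
    · simpa [orient] using h4
  have hn := packedRotSet_nonempty hL pos (fun _ => false) hne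
  have hbd := isBounded_placedRect B 0
  refine (optRotArea_le hpack).trans (mul_le_mul ?_ ?_ (boxHeight_nonneg (hbd.subset hsub)) hB.1.le)
  · exact (boxWidth_mono hn hbd hsub).trans_eq (boxWidth_placedRect hB 0)
  · exact (boxHeight_mono hn hbd hsub).trans_eq (boxHeight_placedRect hB 0)

theorem packedRotSet_online_subset_append (σ : List Piece → (ℝ × ℝ) × Bool) (L : List Piece)
    (q : Piece) :
    packedRotSet L (onlineRotPos σ L) (onlineRot σ L) ⊆
      packedRotSet (L ++ [q]) (onlineRotPos σ (L ++ [q])) (onlineRot σ (L ++ [q])) := by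
  refine iUnion_subset fun i => ?_
  have hi : (i : ℕ) < (L ++ [q]).length := by simp
  have h := placedRect_subset_packedRotSet (L ++ [q]) (onlineRotPos σ (L ++ [q]))
    (onlineRot σ (L ++ [q])) ⟨i, hi⟩
  have htake : (L ++ [q]).take (i + 1) = L.take (i + 1) := List.take_append_of_le_length (by omega)
  simpa [onlineRotPos, onlineRot, htake] using h

theorem exists_placedRect_last_subset (L : List Piece) (q : Piece)
    (pos : Fin (L ++ [q]).length → ℝ × ℝ) (rot : Fin (L ++ [q]).length → Bool) :
    ∃ r x, placedRect (orient q r) x ⊆ packedRotSet (L ++ [q]) pos rot := by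
  have hi : L.length < (L ++ [q]).length := by simp
  have h := placedRect_subset_packedRotSet (L ++ [q]) pos rot ⟨L.length, hi⟩
  exact ⟨rot ⟨L.length, hi⟩, pos ⟨L.length, hi⟩, by simpa using h⟩

theorem get_replicate_append_singleton (N : ℕ) (a q : Piece)
    (i : Fin (List.replicate N a ++ [q]).length) :
    (List.replicate N a ++ [q]).get i = if (i : ℕ) < N then a else q := by
  simp [List.getElem_append]

/-- `N` copies of `p × p/N` and a square of side `p` fit in a `p × 2p` box. -/
theorem optRotArea_strips_square_le {N : ℕ} (hN : 0 < N) {p : ℝ} (hp : 0 < p) :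
    optRotArea (List.replicate N (p, p / N) ++ [(p, p)]) ≤ 2 * p ^ 2 := by
  have hN' : (0 : ℝ) < N := by exact_mod_cast hN
  have hd : 0 < p / N := by positivity
  have key : ∀ k : ℕ, k < N → (k : ℝ) * (p / N) + p / N ≤ p := by
    intro k hk
    have : (k : ℝ) + 1 ≤ N := by exact_mod_cast hk
    calc (k : ℝ) * (p / N) + p / N = (k + 1) * (p / N) := by ring
      _ ≤ N * (p / N) := by gcongr
      _ = p := by field_simp
  have hL : ∀ q ∈ List.replicate N ((p, p / N) : Piece) ++ [(p, p)], PiecePos q := by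
    intro q hq
    rcases List.mem_append.1 hq with h | h
    · rw [List.eq_of_mem_replicate h]; exact ⟨hp, hd⟩
    · rw [List.mem_singleton.1 h]; exact ⟨hp, hp⟩
  refine (optRotArea_le_of_separated hL (by simp)
    (fun i => if (i : ℕ) < N then (0, (i : ℕ) * (p / N)) else (0, p)) (B := (p, 2 * p))
    ⟨hp, by positivity⟩ ?_ ?_).trans_eq (by ring)
  · intro i j hij
    have hij' : (i : ℕ) < j := hij
    have hj : (j : ℕ) < N + 1 := by simpa using j.2
    have hi : (i : ℕ) < N := by omega
    rw [get_replicate_append_singleton]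
    right
    simp only [hi, if_true]
    split_ifs
    · have : ((i : ℕ) : ℝ) + 1 ≤ (j : ℕ) := by exact_mod_cast hij'
      nlinarith
    · exact key _ hi
  · intro i
    rw [get_replicate_append_singleton]
    by_cases hi : (i : ℕ) < N
    · simp only [hi, if_true]
      have := key _ hi
      exact ⟨le_rfl, by simp, by positivity, by linarith⟩
    · simp only [hi, if_false]
      exact ⟨le_rfl, by simp, hp.le, by linarith⟩

/-- `N` copies of `p × p/N` and a strip `Np × p/N` fit in an `Np × 2p/N` box. -/
theorem optRotArea_strips_long_strip_le {N : ℕ} (hN : 0 < N) {p : ℝ} (hp : 0 < p) :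
    optRotArea (List.replicate N (p, p / N) ++ [(N * p, p / N)]) ≤ 2 * p ^ 2 := by
  have hN' : (0 : ℝ) < N := by exact_mod_cast hN
  have hd : 0 < p / N := by positivity
  have hNp : 0 < N * p := by positivity
  have hL : ∀ q ∈ List.replicate N ((p, p / N) : Piece) ++ [(N * p, p / N)], PiecePos q := by
    intro q hq
    rcases List.mem_append.1 hq with h | h
    · rw [List.eq_of_mem_replicate h]; exact ⟨hp, hd⟩
    · rw [List.mem_singleton.1 h]; exact ⟨hNp, hd⟩
  refine (optRotArea_le_of_separated hL (by simp)
    (fun i => if (i : ℕ) < N then ((i : ℕ) * p, 0) else (0, p / N)) (B := (N * p, 2 * (p / N)))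
    ⟨hNp, by positivity⟩ ?_ ?_).trans_eq (by field_simp)
  · intro i j hij
    have hij' : (i : ℕ) < j := hij
    have hj : (j : ℕ) < N + 1 := by simpa using j.2
    have hi : (i : ℕ) < N := by omega
    rw [get_replicate_append_singleton]
    simp only [hi, if_true]
    split_ifs
    · left
      have : ((i : ℕ) : ℝ) + 1 ≤ (j : ℕ) := by exact_mod_cast hij'
      nlinarith
    · right
      simp
  · intro i
    rw [get_replicate_append_singleton]
    by_cases hi : (i : ℕ) < N
    · simp only [hi, if_true]
      have : ((i : ℕ) : ℝ) + 1 ≤ N := by exact_mod_cast hi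
      exact ⟨by positivity, by nlinarith, le_rfl, by linarith⟩
    · simp only [hi, if_false]
      exact ⟨le_rfl, by simp, hd.le, by linarith⟩


/-- For every valid online rotation strategy `σ`, every integer
`m ≥ 1` and every real `p > 0`, there exists a stream `L` of `m² + 1` pieces
such that `OPT(L) ≤ 2p²` and `ALG_σ(L) ≥ m * p²` (area of the bounding box,
rotations by 90° allowed). -/
theorem area_rotation_adversary
    (σ : List Piece → (ℝ × ℝ) × Bool) (hσ : RotStrategyValid σ)
    (m : ℕ) (hm : 1 ≤ m) (p : ℝ) (hp : 0 < p) :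
    ∃ L : List Piece, L.length = m ^ 2 + 1 ∧ (∀ q ∈ L, PiecePos q) ∧
      optRotArea L ≤ 2 * p ^ 2 ∧ (m : ℝ) * p ^ 2 ≤ algRotArea σ L := by
  have hm' : (0 : ℝ) < m := by exact_mod_cast hm
  have hN : 0 < m ^ 2 := by positivity
  have hd : 0 < p / (m ^ 2 : ℕ) := by positivity
  set P : List Piece := List.replicate (m ^ 2) (p, p / (m ^ 2 : ℕ)) with hP
  have hPpos : ∀ q ∈ P, PiecePos q := fun q hq => by
    rw [List.eq_of_mem_replicate hq]; exact ⟨hp, hd⟩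
  have hPne : P ≠ [] := by simp [hP]; omega
  have happ : ∀ q, PiecePos q → ∀ x ∈ P ++ [q], PiecePos x := fun q hq x hx => by
    rcases List.mem_append.1 hx with h | h
    · exact hPpos x h
    · rwa [List.mem_singleton.1 h]
  set S := packedRotSet P (onlineRotPos σ P) (onlineRot σ P) with hS
  have hSne : S.Nonempty := packedRotSet_nonempty hPpos _ _ hPne
  have harea : p ^ 2 ≤ boxWidth S * boxHeight S := by
    refine le_trans (le_of_eq ?_) ((hσ P hPpos).sum_area_le hPpos)
    simp [hP]
    field_simp
  -- The final box dominates the bounding boxes of the prefix and of the last piece.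
  have hfinal : ∀ q, PiecePos q → ∃ W H : ℝ, algRotArea σ (P ++ [q]) = W * H ∧
      boxWidth S ≤ W ∧ boxHeight S ≤ H ∧ (q.1 ≤ W ∧ q.2 ≤ H ∨ q.2 ≤ W ∧ q.1 ≤ H) := by
    intro q hq
    have hb := isBounded_packedRotSet (P ++ [q]) (onlineRotPos σ (P ++ [q]))
      (onlineRot σ (P ++ [q]))
    have hsub := packedRotSet_online_subset_append σ P q
    obtain ⟨r, x, hx⟩ := exists_placedRect_last_subset P q (onlineRotPos σ (P ++ [q]))
      (onlineRot σ (P ++ [q]))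
    have hw := boxWidth_mono (placedRect_nonempty (hq.orient r) x) hb hx
    have hh := boxHeight_mono (placedRect_nonempty (hq.orient r) x) hb hx
    rw [boxWidth_placedRect (hq.orient r)] at hw
    rw [boxHeight_placedRect (hq.orient r)] at hh
    refine ⟨_, _, rfl, boxWidth_mono hSne hb hsub, boxHeight_mono hSne hb hsub, ?_⟩
    cases r
    · exact Or.inl ⟨hw, hh⟩
    · exact Or.inr ⟨hw, hh⟩
  have hbS : Bornology.IsBounded S := isBounded_packedRotSet _ _ _
  have hw0 := boxWidth_nonneg hbS
  have hh0 := boxHeight_nonneg hbS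
  have hdm : p / m * m = p := by field_simp
  by_cases hcase : p / m ≤ boxWidth S ∧ p / m ≤ boxHeight S
  · obtain ⟨hw, hh⟩ := hcase
    have hq : PiecePos (((m ^ 2 : ℕ) : ℝ) * p, p / (m ^ 2 : ℕ)) := ⟨by positivity, hd⟩
    refine ⟨P ++ [_], by simp [hP], happ _ hq, optRotArea_strips_long_strip_le hN hp, ?_⟩
    obtain ⟨W, H, hA, hW, hH, h⟩ := hfinal _ hq
    have heq : (m : ℝ) * p ^ 2 = ((m ^ 2 : ℕ) : ℝ) * p * (p / m) := by
      push_cast; field_simp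
    rw [hA, heq]
    rcases h with ⟨h, -⟩ | ⟨-, h⟩
    · exact mul_le_mul h (hh.trans hH) (by positivity) (hw0.trans hW)
    · rw [mul_comm W H]
      exact mul_le_mul h (hw.trans hW) (by positivity) (hh0.trans hH)
  · have hq : PiecePos (p, p) := ⟨hp, hp⟩
    refine ⟨P ++ [_], by simp [hP], happ _ hq, optRotArea_strips_square_le hN hp, ?_⟩
    obtain ⟨W, H, hA, hW, hH, h⟩ := hfinal _ hq
    obtain ⟨hpW, hpH⟩ : p ≤ W ∧ p ≤ H := by simpa using h
    have hlong : ∀ a b : ℝ, 0 ≤ a → b < p / m → p ^ 2 ≤ a * b → m * p ≤ a := by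
      intro a b ha hb hab
      have h1 : p ^ 2 ≤ a * (p / m) := hab.trans (mul_le_mul_of_nonneg_left hb.le ha)
      rw [mul_div_assoc', le_div_iff₀ hm'] at h1
      nlinarith
    have heq : (m : ℝ) * p ^ 2 = m * p * p := by ring
    rw [hA, heq]
    rcases not_and_or.1 hcase with h | h
    · have := hlong _ _ hh0 (not_le.1 h) (by rwa [mul_comm])
      rw [mul_comm W H]
      exact mul_le_mul (this.trans hH) hpW hp.le (hh0.trans hH)
    · have := hlong _ _ hw0 (not_le.1 h) harea
      exact mul_le_mul (this.trans hW) hpH hp.le (hw0.trans hW)
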